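/- Let m ∈ ℕ, 1 ≤ pᵢ < ∞ for i = 1,…,m, and ω⃗ = (ω₁,…,ω_m) ∈ A_{P⃗} ∩ (A_∞)^m. Then for every ball B = B(x₀,r) ⊆ ℝⁿ and all fᵢ ∈ L^{pᵢ}_{loc}(ωᵢ dx), Σ_{j=1}^∞ ∏_{i=1}^m |2^{j+1}B|^{-1} ∫_{2^{j+1}B} |fᵢ(yᵢ)| dyᵢ ≲ ∫_{2r}^∞ ∏_{i=1}^m ‖fᵢ‖_{L^{pᵢ}(B(x₀,t), ωᵢ dx)} ωᵢ(B(x₀,t))^{-1/pᵢ} dt/t, with implicit constant independent of x₀, r, and f⃗. -/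

import Mathlib

open MeasureTheory Metric Set Filter Function
open scoped ENNReal NNReal BigOperators Topology FourierTransform

noncomputable section

/-- Euclidean space `ℝⁿ`. -/
abbrev Rn (n : ℕ) : Type := EuclideanSpace ℝ (Fin n)

namespace GWM

variable {n m : ℕ}

/-- The weighted measure `ω(E) = ∫_E ω(x) dx`. -/
def wMeas (ω : Rn n → ℝ) (E : Set (Rn n)) : ℝ≥0∞ :=
  ∫⁻ x in E, ENNReal.ofReal (ω x)

/-- `(∫_E g(x)^p ω(x) dx)^(1/p)` for an `ℝ≥0∞`-valued `g`. -/
def wLpNormE (p : ℝ) (ω : Rn n → ℝ) (E : Set (Rn n)) (g : Rn n → ℝ≥0∞) : ℝ≥0∞ :=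
  (∫⁻ x in E, g x ^ p * ENNReal.ofReal (ω x)) ^ (1 / p)

/-- The weighted Lebesgue norm `‖f‖_{L^p(E, ω dx)}`. -/
def wLpNorm (p : ℝ) (ω : Rn n → ℝ) (E : Set (Rn n)) (f : Rn n → ℝ) : ℝ≥0∞ :=
  wLpNormE p ω E fun x => ENNReal.ofReal |f x|

/-- The weak weighted Lebesgue norm, `ℝ≥0∞`-valued version. -/
def wWeakLpNormE (p : ℝ) (ω : Rn n → ℝ) (E : Set (Rn n)) (g : Rn n → ℝ≥0∞) : ℝ≥0∞ :=
  ⨆ (α : ℝ) (_ : 0 < α), ENNReal.ofReal α * wMeas ω {x ∈ E | ENNReal.ofReal α < g x} ^ (1 / p)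

/-- The weak weighted Lebesgue norm `‖f‖_{WL^p(E, ω dx)}`. -/
def wWeakLpNorm (p : ℝ) (ω : Rn n → ℝ) (E : Set (Rn n)) (f : Rn n → ℝ) : ℝ≥0∞ :=
  wWeakLpNormE p ω E fun x => ENNReal.ofReal |f x|

/-- The generalized weighted Morrey norm (`ℝ≥0∞`-valued function version). -/
def morreyNormE (p : ℝ) (φ : Rn n → ℝ → ℝ) (ω : Rn n → ℝ) (g : Rn n → ℝ≥0∞) : ℝ≥0∞ :=
  ⨆ (x : Rn n) (r : ℝ) (_ : 0 < r),
    (ENNReal.ofReal (φ x r))⁻¹ * wMeas ω (ball x r) ^ (-(1 / p)) * wLpNormE p ω (ball x r) g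

/-- The generalized weighted Morrey norm `‖f‖_{M^{p,φ}(ω)}`. -/
def morreyNorm (p : ℝ) (φ : Rn n → ℝ → ℝ) (ω : Rn n → ℝ) (f : Rn n → ℝ) : ℝ≥0∞ :=
  morreyNormE p φ ω fun x => ENNReal.ofReal |f x|

/-- The weak generalized weighted Morrey norm (`ℝ≥0∞`-valued version). -/
def weakMorreyNormE (p : ℝ) (φ : Rn n → ℝ → ℝ) (ω : Rn n → ℝ) (g : Rn n → ℝ≥0∞) : ℝ≥0∞ :=
  ⨆ (x : Rn n) (r : ℝ) (_ : 0 < r),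
    (ENNReal.ofReal (φ x r))⁻¹ * wMeas ω (ball x r) ^ (-(1 / p)) * wWeakLpNormE p ω (ball x r) g

/-- The weak generalized weighted Morrey norm `‖f‖_{WM^{p,φ}(ω)}`. -/
def weakMorreyNorm (p : ℝ) (φ : Rn n → ℝ → ℝ) (ω : Rn n → ℝ) (f : Rn n → ℝ) : ℝ≥0∞ :=
  weakMorreyNormE p φ ω fun x => ENNReal.ofReal |f x|

/-- The generalized local weighted Morrey norm at `x₀` (`ℝ≥0∞`-valued version). -/
def localMorreyNormE (x₀ : Rn n) (p : ℝ) (φ : Rn n → ℝ → ℝ) (ω : Rn n → ℝ)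
    (g : Rn n → ℝ≥0∞) : ℝ≥0∞ :=
  ⨆ (r : ℝ) (_ : 0 < r),
    (ENNReal.ofReal (φ x₀ r))⁻¹ * wMeas ω (ball x₀ r) ^ (-(1 / p)) * wLpNormE p ω (ball x₀ r) g

/-- The generalized local weighted Morrey norm `‖f‖_{M_{x₀}^{p,φ}(ω)}`. -/
def localMorreyNorm (x₀ : Rn n) (p : ℝ) (φ : Rn n → ℝ → ℝ) (ω : Rn n → ℝ)
    (f : Rn n → ℝ) : ℝ≥0∞ :=
  localMorreyNormE x₀ p φ ω fun x => ENNReal.ofReal |f x|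

/-- The weak generalized local weighted Morrey norm (`ℝ≥0∞`-valued version). -/
def localWeakMorreyNormE (x₀ : Rn n) (p : ℝ) (φ : Rn n → ℝ → ℝ) (ω : Rn n → ℝ)
    (g : Rn n → ℝ≥0∞) : ℝ≥0∞ :=
  ⨆ (r : ℝ) (_ : 0 < r),
    (ENNReal.ofReal (φ x₀ r))⁻¹ * wMeas ω (ball x₀ r) ^ (-(1 / p)) *
      wWeakLpNormE p ω (ball x₀ r) g

/-- The weak generalized local weighted Morrey norm `‖f‖_{WM_{x₀}^{p,φ}(ω)}`. -/
def localWeakMorreyNorm (x₀ : Rn n) (p : ℝ) (φ : Rn n → ℝ → ℝ) (ω : Rn n → ℝ)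
    (f : Rn n → ℝ) : ℝ≥0∞ :=
  localWeakMorreyNormE x₀ p φ ω fun x => ENNReal.ofReal |f x|

/-- Membership in the generalized weighted Morrey space `M^{p,φ}(ω)`. -/
def MemMorrey (p : ℝ) (φ : Rn n → ℝ → ℝ) (ω : Rn n → ℝ) (f : Rn n → ℝ) : Prop :=
  LocallyIntegrable f volume ∧ morreyNorm p φ ω f < ⊤

/-- Membership in the generalized local weighted Morrey space `M_{x₀}^{p,φ}(ω)`. -/
def MemLocalMorrey (x₀ : Rn n) (p : ℝ) (φ : Rn n → ℝ → ℝ) (ω : Rn n → ℝ)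
    (f : Rn n → ℝ) : Prop :=
  LocallyIntegrable f volume ∧ localMorreyNorm x₀ p φ ω f < ⊤

/-- A weight: a nonnegative locally integrable function, positive a.e. -/
def IsWeight (ω : Rn n → ℝ) : Prop :=
  LocallyIntegrable ω volume ∧ (∀ x, 0 ≤ ω x) ∧
    ∀ᵐ x ∂(volume : Measure (Rn n)), 0 < ω x

/-- The Muckenhoupt class `A₁`. -/
def IsA1 (ω : Rn n → ℝ) : Prop :=
  ∃ C : ℝ≥0, ∀ (x : Rn n) (r : ℝ), 0 < r →
    wMeas ω (ball x r) ≤ C * volume (ball x r) *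
      essInf (fun y => ENNReal.ofReal (ω y)) (volume.restrict (ball x r))

/-- The Muckenhoupt class `A_q`, `1 < q < ∞`. -/
def IsAq (q : ℝ) (ω : Rn n → ℝ) : Prop :=
  ∃ C : ℝ≥0, ∀ (x : Rn n) (r : ℝ), 0 < r →
    (volume (ball x r))⁻¹ * wMeas ω (ball x r) *
      ((volume (ball x r))⁻¹ *
        ∫⁻ y in ball x r, ENNReal.ofReal (ω y) ^ (-(1 / (q - 1)))) ^ (q - 1) ≤ C

/-- The Muckenhoupt class `A_∞ = ⋃_{1 ≤ q < ∞} A_q`. -/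
def IsAinf (ω : Rn n → ℝ) : Prop := IsA1 ω ∨ ∃ q : ℝ, 1 < q ∧ IsAq q ω

/-- The multiple weight `ν_{ω⃗} = ∏ ωᵢ^{p/pᵢ}`. -/
def nuw (p : ℝ) (ps : Fin m → ℝ) (ωs : Fin m → Rn n → ℝ) : Rn n → ℝ :=
  fun x => ∏ i, ωs i x ^ (p / ps i)

/-- The factor `(|B|⁻¹ ∫_B ωᵢ^{1-pᵢ'})^{1/pᵢ'}` in the `A_{P⃗}` condition, with the usual
modification `(essinf_B ωᵢ)⁻¹` when `pᵢ = 1`. -/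
def APfactor (q : ℝ) (ω : Rn n → ℝ) (E : Set (Rn n)) : ℝ≥0∞ :=
  if q = 1 then (essInf (fun y => ENNReal.ofReal (ω y)) (volume.restrict E))⁻¹
  else ((volume E)⁻¹ * ∫⁻ y in E, ENNReal.ofReal (ω y) ^ (-(1 / (q - 1)))) ^ ((q - 1) / q)

/-- The multiple Muckenhoupt condition `ω⃗ ∈ A_{P⃗}`. -/
def IsMultiAP (p : ℝ) (ps : Fin m → ℝ) (ωs : Fin m → Rn n → ℝ) : Prop :=
  ∃ C : ℝ≥0, ∀ (x : Rn n) (r : ℝ), 0 < r →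
    ((volume (ball x r))⁻¹ * wMeas (nuw p ps ωs) (ball x r)) ^ (1 / p) *
      ∏ i, APfactor (ps i) (ωs i) (ball x r) ≤ C

/-- The average `b_E = |E|⁻¹ ∫_E b`. -/
def ballAvg (b : Rn n → ℝ) (E : Set (Rn n)) : ℝ := (∫ y in E, b y) / (volume E).toReal

/-- The BMO norm `‖b‖_{BMO} = sup_B |B|⁻¹ ∫_B |b - b_B|`. -/
def bmoNorm (b : Rn n → ℝ) : ℝ≥0∞ :=
  ⨆ (x : Rn n) (r : ℝ) (_ : 0 < r),
    (volume (ball x r))⁻¹ * ∫⁻ y in ball x r, ENNReal.ofReal |b y - ballAvg b (ball x r)|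

/-- `b ∈ BMO`. -/
def MemBMO (b : Rn n → ℝ) : Prop := LocallyIntegrable b volume ∧ bmoNorm b < ⊤

/-- `f⁰ = f·χ_{2B}` for the ball `B = B(x₀,r)`. -/
def loc0 (x₀ : Rn n) (r : ℝ) (f : Rn n → ℝ) : Rn n → ℝ := (ball x₀ (2 * r)).indicator f

/-- `f^∞ = f·χ_{(2B)ᶜ}` for the ball `B = B(x₀,r)`. -/
def locInf (x₀ : Rn n) (r : ℝ) (f : Rn n → ℝ) : Rn n → ℝ := (ball x₀ (2 * r))ᶜ.indicator f

/-- `Σ_{j=1}^∞ ∏_{i=1}^m |2^{j+1}B|⁻¹ ∫_{2^{j+1}B} |fᵢ|`, for `B = B(x₀,r)`. -/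
def lsSum (x₀ : Rn n) (r : ℝ) (f : Fin m → Rn n → ℝ) : ℝ≥0∞ :=
  ∑' j : ℕ, ∏ i, (volume (ball x₀ (2 ^ (j + 2) * r)))⁻¹ *
    ∫⁻ y in ball x₀ (2 ^ (j + 2) * r), ENNReal.ofReal |f i y|

/-- The local size condition `T ∈ LS(∏ Xᵢ)`. -/
def LS (T : (Fin m → Rn n → ℝ) → Rn n → ℝ) (X : Fin m → (Rn n → ℝ) → Prop) : Prop :=
  ∃ C : ℝ≥0, ∀ (x₀ : Rn n) (r : ℝ), 0 < r → ∀ f : Fin m → Rn n → ℝ, (∀ i, X i (f i)) →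
    ∀ ℓ : ℕ, 1 ≤ ℓ → ℓ ≤ m →
      essSup
        (fun x => ENNReal.ofReal
          |T (fun i => if (i : ℕ) < ℓ then locInf x₀ r (f i) else loc0 x₀ r (f i)) x|)
        (volume.restrict (ball x₀ r)) ≤ C * lsSum x₀ r f

/-- The local boundedness condition `T ∈ LB(∏ Xᵢ → Y)`. -/
def LB (T : (Fin m → Rn n → ℝ) → Rn n → ℝ) (X : Fin m → (Rn n → ℝ) → Prop)
    (Xnorm : Fin m → (Rn n → ℝ) → ℝ≥0∞) (Ynorm : (Rn n → ℝ) → ℝ≥0∞) : Prop :=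
  ∃ C : ℝ≥0, ∀ (x₀ : Rn n) (r : ℝ), 0 < r → ∀ f : Fin m → Rn n → ℝ, (∀ i, X i (f i)) →
    Ynorm (T fun i => loc0 x₀ r (f i)) ≤ C * ∏ i, Xnorm i (f i)

/-- `T` is `m`-sublinear (subadditive in each entry). -/
def MSublinear (T : (Fin m → Rn n → ℝ) → Rn n → ℝ) : Prop :=
  ∀ (f : Fin m → Rn n → ℝ) (i : Fin m) (g h : Rn n → ℝ) (x : Rn n),
    |T (Function.update f i (g + h)) x| ≤
      |T (Function.update f i g) x| + |T (Function.update f i h) x|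

/-- Pointwise size condition `|T(f⃗)(x)| ≲ ∫ ∏|fᵢ(yᵢ)| (Σ|x-yⱼ|)^{-mn} dy⃗`
for `x ∉ ⋂ supp fⱼ`. -/
def PointwiseSize (T : (Fin m → Rn n → ℝ) → Rn n → ℝ)
    (X : Fin m → (Rn n → ℝ) → Prop) : Prop :=
  ∃ C : ℝ≥0, ∀ f : Fin m → Rn n → ℝ, (∀ i, X i (f i)) →
    ∀ x : Rn n, x ∉ ⋂ j, Function.support (f j) →
      ENNReal.ofReal |T f x| ≤
        C * ∫⁻ y : Fin m → Rn n,
          (∏ i, ENNReal.ofReal |f i (y i)|) *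
            ENNReal.ofReal (∑ j, dist x (y j)) ^ (-(m * n : ℝ))

/-- The iterated commutator `T_{Π b⃗}`. -/
def iterComm (T : (Fin m → Rn n → ℝ) → Rn n → ℝ) (b f : Fin m → Rn n → ℝ) : Rn n → ℝ :=
  fun x => T (fun i y => (b i x - b i y) * f i y) x

/-- The multilinear commutator `T_{Σ b⃗}`. -/
def sumComm (T : (Fin m → Rn n → ℝ) → Rn n → ℝ) (b f : Fin m → Rn n → ℝ) : Rn n → ℝ :=
  fun x => ∑ j, T (Function.update f j fun y => (b j x - b j y) * f j y) x

/-- `essinf_{t<η<∞} ∏ᵢ φ₁ᵢ(x,η) ωᵢ(B(x,η))^{1/pᵢ}`. -/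
def essInfProd (ps : Fin m → ℝ) (φ1 : Fin m → Rn n → ℝ → ℝ) (ωs : Fin m → Rn n → ℝ)
    (x : Rn n) (t : ℝ) : ℝ≥0∞ :=
  essInf (fun η => ∏ i, ENNReal.ofReal (φ1 i x η) * wMeas (ωs i) (ball x η) ^ (1 / ps i))
    (volume.restrict (Ioi t))

/-- The quantity inside the supremum in the conditions `[φ⃗₁,φ₂]` (with logarithmic factor
`(1+log(t/r))^k`). -/
def phiCondAt (k : ℕ) (ps : Fin m → ℝ) (φ1 : Fin m → Rn n → ℝ → ℝ)
    (ωs : Fin m → Rn n → ℝ) (φ2 : Rn n → ℝ → ℝ) (x : Rn n) (r : ℝ) : ℝ≥0∞ :=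
  (ENNReal.ofReal (φ2 x r))⁻¹ *
    ∫⁻ t in Ioi r,
      ENNReal.ofReal (1 + Real.log (t / r)) ^ k * essInfProd ps φ1 ωs x t *
        (∏ i, wMeas (ωs i) (ball x t) ^ (1 / ps i))⁻¹ * (ENNReal.ofReal t)⁻¹

/-- The condition `[φ⃗₁,φ₂] < ∞` (`k = 0`: condition `[·]₁`; `k = m`: condition `[·]₂`;
`k = 1`: condition `[·]₃`). -/
def phiCond (k : ℕ) (ps : Fin m → ℝ) (φ1 : Fin m → Rn n → ℝ → ℝ)
    (ωs : Fin m → Rn n → ℝ) (φ2 : Rn n → ℝ → ℝ) : Prop :=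
  (⨆ (x : Rn n) (r : ℝ) (_ : 0 < r), phiCondAt k ps φ1 ωs φ2 x r) < ⊤

/-- The local (at `x₀`) condition `[φ⃗₁,φ₂]' < ∞`. -/
def phiCondLoc (x₀ : Rn n) (k : ℕ) (ps : Fin m → ℝ) (φ1 : Fin m → Rn n → ℝ → ℝ)
    (ωs : Fin m → Rn n → ℝ) (φ2 : Rn n → ℝ → ℝ) : Prop :=
  (⨆ (r : ℝ) (_ : 0 < r), phiCondAt k ps φ1 ωs φ2 x₀ r) < ⊤



/-! ### Variable exponent spaces -/

/-- The Luxemburg norm `‖f‖_{L^{p(·)}}`. -/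
def luxNorm (p : Rn n → ℝ) (f : Rn n → ℝ) : ℝ≥0∞ :=
  ⨅ (lam : ℝ≥0∞) (_ : lam ≠ 0)
    (_ : (∫⁻ x, (ENNReal.ofReal |f x| / lam) ^ p x) ≤ 1), lam

/-- `‖f‖_{L^{p(·)}(E)} = ‖f χ_E‖_{L^{p(·)}}`. -/
def luxNormOn (p : Rn n → ℝ) (E : Set (Rn n)) (f : Rn n → ℝ) : ℝ≥0∞ :=
  luxNorm p (E.indicator f)

/-- `p(·) ∈ 𝒫`: measurable with `1 < p⁻ ≤ p⁺ < ∞`. -/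
def MemP (p : Rn n → ℝ) : Prop :=
  Measurable p ∧ ∃ a b : ℝ, 1 < a ∧ ∀ x, a ≤ p x ∧ p x ≤ b

/-- `p(·) ∈ LH`: global log-Hölder continuity. -/
def LogHolder (p : Rn n → ℝ) : Prop :=
  (∃ C : ℝ, ∀ x y : Rn n, 0 < dist x y → dist x y ≤ 1 / 2 →
    |p x - p y| ≤ C / (-Real.log (dist x y))) ∧
  (∃ C : ℝ, ∀ x y : Rn n, ‖x‖ ≤ ‖y‖ →
    |p x - p y| ≤ C / Real.log (Real.exp 1 + ‖x‖))

/-- The conjugate exponent function `p'(·) = p(·)/(p(·)-1)`. -/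
def conjExp (p : Rn n → ℝ) : Rn n → ℝ := fun x => p x / (p x - 1)

/-- The variable exponent Muckenhoupt class `A_{p(·)}`. -/
def IsAvar (p : Rn n → ℝ) (ω : Rn n → ℝ) : Prop :=
  ∃ C : ℝ≥0, ∀ (x : Rn n) (r : ℝ), 0 < r →
    (volume (ball x r))⁻¹ * luxNormOn p (ball x r) ω *
      luxNormOn (conjExp p) (ball x r) (fun y => (ω y)⁻¹) ≤ C

/-- The generalized weighted variable exponent Morrey norm `‖f‖_{M^{p(·),φ}(ω)}`. -/
def varMorreyNorm (p : Rn n → ℝ) (φ : Rn n → ℝ → ℝ) (ω f : Rn n → ℝ) : ℝ≥0∞ :=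
  ⨆ (x : Rn n) (r : ℝ) (_ : 0 < r),
    (ENNReal.ofReal (φ x r))⁻¹ * (luxNormOn p (ball x r) ω)⁻¹ *
      luxNormOn p (ball x r) (fun y => ω y * f y)

/-- Membership in `M^{p(·),φ}(ω)`. -/
def MemVarMorrey (p : Rn n → ℝ) (φ : Rn n → ℝ → ℝ) (ω f : Rn n → ℝ) : Prop :=
  LocallyIntegrable f volume ∧ varMorreyNorm p φ ω f < ⊤

/-- `essinf_{t<η<∞} ∏ᵢ φ₁ᵢ(x,η) ‖ωᵢ‖_{L^{pᵢ(·)}(B(x,η))}`. -/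
def varEssInfProd (ps : Fin m → Rn n → ℝ) (φ1 : Fin m → Rn n → ℝ → ℝ)
    (ωs : Fin m → Rn n → ℝ) (x : Rn n) (t : ℝ) : ℝ≥0∞ :=
  essInf (fun η => ∏ i, ENNReal.ofReal (φ1 i x η) * luxNormOn (ps i) (ball x η) (ωs i))
    (volume.restrict (Ioi t))

/-- The variable exponent condition `[φ⃗₁,φ₂]'' < ∞` (with log factor `(1+log(t/r))^k`). -/
def varPhiCond (k : ℕ) (ps : Fin m → Rn n → ℝ) (φ1 : Fin m → Rn n → ℝ → ℝ)
    (ωs : Fin m → Rn n → ℝ) (φ2 : Rn n → ℝ → ℝ) : Prop :=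
  (⨆ (x : Rn n) (r : ℝ) (_ : 0 < r),
    (ENNReal.ofReal (φ2 x r))⁻¹ *
      ∫⁻ t in Ioi r,
        ENNReal.ofReal (1 + Real.log (t / r)) ^ k * varEssInfProd ps φ1 ωs x t *
          (∏ i, luxNormOn (ps i) (ball x t) (ωs i))⁻¹ * (ENNReal.ofReal t)⁻¹) < ⊤

/-! ### Lebesgue norms on all of `ℝⁿ` -/

/-- `(∫ g^q)^(1/q)` for `ℝ≥0∞`-valued `g`. -/
def lpNormE (q : ℝ) (g : Rn n → ℝ≥0∞) : ℝ≥0∞ := (∫⁻ x, g x ^ q) ^ (1 / q)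

/-- The (unweighted) `L^q(ℝⁿ)` norm. -/
def lpNormRn (q : ℝ) (f : Rn n → ℝ) : ℝ≥0∞ := lpNormE q fun x => ENNReal.ofReal |f x|

/-! ### Quasi-Banach valued Calderón–Zygmund operators -/

/-- A quasi-norm making `E` a quasi-Banach space. -/
structure QBNorm (E : Type) [AddCommGroup E] [Module ℝ E] where
  N : E → ℝ
  nonneg : ∀ e, 0 ≤ N e
  eq_zero_iff : ∀ e, N e = 0 ↔ e = 0
  smul_eq : ∀ (c : ℝ) (e : E), N (c • e) = |c| * N e
  kappa : ℝ
  one_le_kappa : 1 ≤ kappa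
  quasi : ∀ e₁ e₂, N (e₁ + e₂) ≤ kappa * (N e₁ + N e₂)
  complete : ∀ u : ℕ → E,
    (∀ ε : ℝ, 0 < ε → ∃ M : ℕ, ∀ j k, M ≤ j → M ≤ k → N (u j - u k) < ε) →
    ∃ e : E, ∀ ε : ℝ, 0 < ε → ∃ M : ℕ, ∀ j, M ≤ j → N (u j - e) < ε

/-- An `m`-linear `𝔅`-valued Calderón–Zygmund operator on `ℝⁿ`, together with its kernel,
defined on products of generalized weighted Morrey spaces via the decomposition
`T(f⃗) = Σ_{α⃗} T(f₁^{α₁},…,f_m^{α_m})`. -/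
structure MultiCZB (n m : ℕ) (E : Type) [AddCommGroup E] [Module ℝ E] (Q : QBNorm E) where
  T : (Fin m → Rn n → ℝ) → Rn n → E
  K : Rn n → (Fin m → Rn n) → E
  add_coord : ∀ (f : Fin m → Rn n → ℝ) (i : Fin m) (g h : Rn n → ℝ) (x : Rn n),
    T (Function.update f i (g + h)) x = T (Function.update f i g) x + T (Function.update f i h) x
  smul_coord : ∀ (f : Fin m → Rn n → ℝ) (i : Fin m) (c : ℝ) (g : Rn n → ℝ) (x : Rn n),
    T (Function.update f i (c • g)) x = c • T (Function.update f i g) x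
  eps : ℝ
  eps_pos : 0 < eps
  A : ℝ≥0
  size : ∀ (x : Rn n) (y : Fin m → Rn n), 0 < ∑ j, dist x (y j) →
    ENNReal.ofReal (Q.N (K x y)) ≤ A * ENNReal.ofReal (∑ j, dist x (y j)) ^ (-(m * n : ℝ))
  reg_y : ∀ (x : Rn n) (y : Fin m → Rn n) (i : Fin m) (y' : Rn n),
    0 < ∑ j, dist x (y j) → dist (y i) y' ≤ (1 / 2) * ⨆ j, dist x (y j) →
    ENNReal.ofReal (Q.N (K x y - K x (Function.update y i y'))) ≤
      A * ENNReal.ofReal (dist (y i) y' ^ eps) *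
        ENNReal.ofReal (∑ j, dist x (y j)) ^ (-(m * n : ℝ) - eps)
  reg_x : ∀ (x x' : Rn n) (y : Fin m → Rn n),
    0 < ∑ j, dist x (y j) → dist x x' ≤ (1 / 2) * ∑ j, dist x (y j) →
    ENNReal.ofReal (Q.N (K x y - K x' y)) ≤
      A * ENNReal.ofReal (dist x x' ^ eps) *
        ENNReal.ofReal (∑ j, dist x (y j)) ^ (-(m * n : ℝ) - eps)
  dom : ∀ (f : Fin m → Rn n → ℝ) (x : Rn n), x ∉ ⋂ j, tsupport (f j) →
    ENNReal.ofReal (Q.N (T f x)) ≤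
      ∫⁻ y : Fin m → Rn n, (∏ i, ENNReal.ofReal |f i (y i)|) * ENNReal.ofReal (Q.N (K x y))
  decomp : ∀ (f : Fin m → Rn n → ℝ) (x₀ : Rn n) (r : ℝ), 0 < r → ∀ x ∈ ball x₀ r,
    T f x = ∑ α : Fin m → Bool,
      T (fun i => if α i then locInf x₀ r (f i) else loc0 x₀ r (f i)) x
  bddLq : ∃ (qs : Fin m → ℝ) (q : ℝ) (C : ℝ≥0), (∀ i, 1 ≤ qs i) ∧ q⁻¹ = ∑ i, (qs i)⁻¹ ∧
    ∀ f : Fin m → Rn n → ℝ,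
      lpNormE q (fun x => ENNReal.ofReal (Q.N (T f x))) ≤ C * ∏ i, lpNormRn (qs i) (f i)

/-! ### Multilinear Littlewood–Paley square operators -/

/-- `K_t(x,y⃗) = t^{-mn} K(x/t, y₁/t, …, y_m/t)`. -/
def Kt (m : ℕ) (K : Rn n → (Fin m → Rn n) → ℝ) (t : ℝ) (x : Rn n)
    (y : Fin m → Rn n) : ℝ :=
  t ^ (-(m * n : ℝ)) * K (t⁻¹ • x) fun i => t⁻¹ • y i

/-- The multilinear square operator
`T(f⃗)(x) = (∫₀^∞ |∫ K_t(x,y⃗) ∏ fⱼ(yⱼ) dy⃗|² dt/t)^{1/2}`. -/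
def sqFn (K : Rn n → (Fin m → Rn n) → ℝ) (f : Fin m → Rn n → ℝ) (x : Rn n) : ℝ≥0∞ :=
  (∫⁻ t in Ioi (0 : ℝ),
      ENNReal.ofReal |∫ y : Fin m → Rn n, Kt m K t x y * ∏ i, f i (y i)| ^ (2 : ℝ) *
        (ENNReal.ofReal t)⁻¹) ^ (1 / 2 : ℝ)

/-- `θ ∈ Dini(1)`: nondecreasing on `[0,∞)`, `0 < θ(1) < ∞`, `∫₀¹ θ(t)/t dt < ∞`. -/
def IsDiniFn (θ : ℝ → ℝ) : Prop :=
  (∀ t, 0 ≤ θ t) ∧ MonotoneOn θ (Ici 0) ∧ 0 < θ 1 ∧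
    (∫⁻ t in Ioo (0 : ℝ) 1, ENNReal.ofReal (θ t) * (ENNReal.ofReal t)⁻¹) < ⊤

/-- `K` is a square-function kernel of type `θ`. -/
def SqKernelType (K : Rn n → (Fin m → Rn n) → ℝ) (θ : ℝ → ℝ) : Prop :=
  ∃ A : ℝ≥0,
    (∀ (x : Rn n) (y : Fin m → Rn n), 0 < ∑ j, dist x (y j) →
      (∫⁻ t in Ioi (0 : ℝ),
          ENNReal.ofReal |Kt m K t x y| ^ (2 : ℝ) * (ENNReal.ofReal t)⁻¹) ^ (1 / 2 : ℝ) ≤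
        A * ENNReal.ofReal (∑ j, dist x (y j)) ^ (-(m * n : ℝ))) ∧
    (∀ (x : Rn n) (y : Fin m → Rn n) (i : Fin m) (y' : Rn n), 0 < ∑ j, dist x (y j) →
      dist (y i) y' ≤ (1 / 2) * ⨆ j, dist x (y j) →
      (∫⁻ t in Ioi (0 : ℝ),
          ENNReal.ofReal |Kt m K t x y - Kt m K t x (Function.update y i y')| ^ (2 : ℝ) *
            (ENNReal.ofReal t)⁻¹) ^ (1 / 2 : ℝ) ≤
        A * ENNReal.ofReal (∑ j, dist x (y j)) ^ (-(m * n : ℝ)) *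
          ENNReal.ofReal (θ (dist (y i) y' / ∑ j, dist x (y j)))) ∧
    (∀ (x z : Rn n) (y : Fin m → Rn n), 0 < ∑ j, dist x (y j) →
      dist z x ≤ (1 / 2) * ⨆ j, dist x (y j) →
      (∫⁻ t in Ioi (0 : ℝ),
          ENNReal.ofReal |Kt m K t z y - Kt m K t x y| ^ (2 : ℝ) *
            (ENNReal.ofReal t)⁻¹) ^ (1 / 2 : ℝ) ≤
        A * ENNReal.ofReal (∑ j, dist x (y j)) ^ (-(m * n : ℝ)) *
          ENNReal.ofReal (θ (dist z x / ∑ j, dist x (y j))))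

/-- The assumed `L^{q₁} × ⋯ × L^{q_m} → L^q` boundedness of the square operator. -/
def SqBddLq (K : Rn n → (Fin m → Rn n) → ℝ) : Prop :=
  ∃ (qs : Fin m → ℝ) (q : ℝ) (C : ℝ≥0), (∀ i, 1 < qs i) ∧ q⁻¹ = ∑ i, (qs i)⁻¹ ∧
    ∀ f : Fin m → Rn n → ℝ, lpNormE q (sqFn K f) ≤ C * ∏ i, lpNormRn (qs i) (f i)

/-- A multilinear Littlewood–Paley kernel. -/
def IsMLPKernel (K : Rn n → (Fin m → Rn n) → ℝ) : Prop :=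
  ∃ A γ δ B₁ : ℝ, 0 < A ∧ 0 < γ ∧ 0 < δ ∧ 0 < B₁ ∧
    (∀ (x : Rn n) (y : Fin m → Rn n),
      |K x y| ≤ A * (1 + ∑ j, dist x (y j)) ^ (-(m * n : ℝ) - δ)) ∧
    (∀ (x : Rn n) (y : Fin m → Rn n) (i : Fin m) (y' : Rn n),
      dist (y i) y' ≤ dist x (y i) / B₁ →
      |K x y - K x (Function.update y i y')| ≤
        A * dist (y i) y' ^ γ * (1 + ∑ j, dist x (y j)) ^ (-(m * n : ℝ) - δ - γ)) ∧
    (∀ (x x' : Rn n) (y : Fin m → Rn n),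
      dist x x' ≤ (⨆ j, dist x (y j)) / B₁ →
      |K x y - K x' y| ≤
        A * dist x x' ^ γ * (1 + ∑ j, dist x (y j)) ^ (-(m * n : ℝ) - δ - γ))

/-- The multilinear Littlewood–Paley `g*_λ` function. -/
def glam (K : Rn n → (Fin m → Rn n) → ℝ) (lam : ℝ) (f : Fin m → Rn n → ℝ)
    (x : Rn n) : ℝ≥0∞ :=
  (∫⁻ t in Ioi (0 : ℝ), ∫⁻ z : Rn n,
      ENNReal.ofReal (t / (dist x z + t)) ^ (n * lam) *
        ENNReal.ofReal |∫ y : Fin m → Rn n, Kt m K t z y * ∏ i, f i (y i)| ^ (2 : ℝ) *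
          (ENNReal.ofReal t) ^ (-(n : ℝ) - 1)) ^ (1 / 2 : ℝ)

/-- The assumed `L^{q₁} × ⋯ × L^{q_m} → L^q` boundedness of the `g*_λ` function. -/
def GlamBddLq (K : Rn n → (Fin m → Rn n) → ℝ) (lam : ℝ) : Prop :=
  ∃ (qs : Fin m → ℝ) (q : ℝ) (C : ℝ≥0), (∀ i, 1 < qs i) ∧ q⁻¹ = ∑ i, (qs i)⁻¹ ∧
    ∀ f : Fin m → Rn n → ℝ, lpNormE q (glam K lam f) ≤ C * ∏ i, lpNormRn (qs i) (f i)

/-- A multilinear Marcinkiewicz kernel. -/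
def IsMarcinkiewiczKernel (K : Rn n → (Fin m → Rn n) → ℝ) : Prop :=
  ∃ A γ δ B₁ : ℝ, 0 < A ∧ 0 < γ ∧ 0 < δ ∧ δ < m * n ∧ 0 < B₁ ∧
    (∀ (x : Rn n) (y : Fin m → Rn n), ¬ (∑ j, dist x (y j) ^ 2) ≤ 1 → K x y = 0) ∧
    (∀ (x : Rn n) (y : Fin m → Rn n), 0 < ∑ j, dist x (y j) →
      |K x y| ≤ A * (∑ j, dist x (y j)) ^ (-(m * n : ℝ) + δ)) ∧
    (∀ (x : Rn n) (y : Fin m → Rn n) (i : Fin m) (y' : Rn n),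
      (∑ j, dist x (y j) ^ 2) ≤ 1 → 0 < ∑ j, dist x (y j) →
      dist (y i) y' ≤ dist x (y i) / B₁ →
      |K x y - K x (Function.update y i y')| ≤
        A * dist (y i) y' ^ γ * (∑ j, dist x (y j)) ^ (-(m * n : ℝ) + δ - γ)) ∧
    (∀ (x x' : Rn n) (y : Fin m → Rn n),
      (∑ j, dist x (y j) ^ 2) ≤ 1 → 0 < ∑ j, dist x (y j) →
      dist x x' ≤ (⨆ j, dist x (y j)) / B₁ →
      |K x y - K x' y| ≤
        A * dist x x' ^ γ * (∑ j, dist x (y j)) ^ (-(m * n : ℝ) + δ - γ))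

/-- `|z⃗| = (Σ |zᵢ|²)^{1/2}` on `(ℝⁿ)^m`. -/
def rho (m : ℕ) (z : Fin m → Rn n) : ℝ := Real.sqrt (∑ i, ‖z i‖ ^ 2)

/-- A multilinear Marcinkiewicz kernel of convolution type with homogeneous `Ω`. -/
def IsConvHomogMarcinkiewicz (K : Rn n → (Fin m → Rn n) → ℝ) : Prop :=
  IsMarcinkiewiczKernel K ∧
  ∃ (Kc : (Fin m → Rn n) → ℝ) (Ω : (Fin m → Rn n) → ℝ) (δ : ℝ),
    0 < δ ∧ δ < m * n ∧
    (∀ (x : Rn n) (y : Fin m → Rn n), K x y = Kc fun i => x - y i) ∧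
    (∀ (c : ℝ) (z : Fin m → Rn n), 0 < c → Ω (c • z) = Ω z) ∧
    (∀ z : Fin m → Rn n, Kc z = if rho m z ≤ 1 then Ω z * rho m z ^ (δ - m * n) else 0)
/-! ### Scalar (complex) multilinear operators: norms, commutators, conclusions -/

/-- View a real function as a complex one. -/
def cToC (f : Rn n → ℝ) : Rn n → ℂ := fun y => (f y : ℂ)

/-- `x ↦ |T(f⃗)(x)|` for a complex-valued multilinear operator applied to real data. -/
def cNorm (Tc : (Fin m → Rn n → ℂ) → Rn n → ℂ) (f : Fin m → Rn n → ℝ) : Rn n → ℝ≥0∞ :=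
  fun x => ENNReal.ofReal ‖Tc (fun i => cToC (f i)) x‖

/-- `x ↦ |T_{Πb⃗}(f⃗)(x)|`. -/
def cIterComm (Tc : (Fin m → Rn n → ℂ) → Rn n → ℂ) (b f : Fin m → Rn n → ℝ) :
    Rn n → ℝ≥0∞ :=
  fun x => ENNReal.ofReal ‖Tc (fun i y => (((b i x - b i y) * f i y : ℝ) : ℂ)) x‖

/-- `x ↦ |T_{Σb⃗}(f⃗)(x)|`. -/
def cSumComm (Tc : (Fin m → Rn n → ℂ) → Rn n → ℂ) (b f : Fin m → Rn n → ℝ) :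
    Rn n → ℝ≥0∞ :=
  fun x => ENNReal.ofReal
    ‖∑ j, Tc (Function.update (fun i => cToC (f i)) j
        fun y => (((b j x - b j y) * f j y : ℝ) : ℂ)) x‖

/-- The boundedness conclusions of Theorems 4.1–4.3 for a complex `m`-linear operator:
strong and weak type on generalized weighted Morrey spaces under `[φ⃗₁,φ₂]₁ < ∞`, and
boundedness of the iterated/multilinear commutators under `[φ⃗₁,φ₂]₂ < ∞` resp.
`[φ⃗₁,φ₂]₃ < ∞`. -/
def Thm41to43Concl (m : ℕ) (Tc : (Fin m → Rn n → ℂ) → Rn n → ℂ) : Prop :=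
  ∀ (ps : Fin m → ℝ) (p : ℝ) (ωs : Fin m → Rn n → ℝ)
    (φ1 : Fin m → Rn n → ℝ → ℝ) (φ2 : Rn n → ℝ → ℝ),
    (∀ k, 1 ≤ ps k) → p⁻¹ = ∑ k, (ps k)⁻¹ → (∀ i, IsWeight (ωs i)) →
    IsMultiAP p ps ωs → (∀ i, IsAinf (ωs i)) →
    (∀ i x r, 0 < r → 0 ≤ φ1 i x r) → (∀ x r, 0 < r → 0 ≤ φ2 x r) →
    ((phiCond 0 ps φ1 ωs φ2 →
      ((∀ k, 1 < ps k) → ∃ C : ℝ≥0, ∀ f : Fin m → Rn n → ℝ,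
        (∀ i, MemMorrey (ps i) (φ1 i) (ωs i) (f i)) →
        morreyNormE p φ2 (nuw p ps ωs) (cNorm Tc f) ≤
          C * ∏ i, morreyNorm (ps i) (φ1 i) (ωs i) (f i)) ∧
      ((∃ k, ps k = 1) → ∃ C : ℝ≥0, ∀ f : Fin m → Rn n → ℝ,
        (∀ i, MemMorrey (ps i) (φ1 i) (ωs i) (f i)) →
        weakMorreyNormE p φ2 (nuw p ps ωs) (cNorm Tc f) ≤
          C * ∏ i, morreyNorm (ps i) (φ1 i) (ωs i) (f i))) ∧
    ((∀ k, 1 < ps k) → ∀ b : Fin m → Rn n → ℝ, (∀ j, MemBMO (b j)) →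
      (phiCond m ps φ1 ωs φ2 → ∃ C : ℝ≥0, ∀ f : Fin m → Rn n → ℝ,
        (∀ i, MemMorrey (ps i) (φ1 i) (ωs i) (f i)) →
        morreyNormE p φ2 (nuw p ps ωs) (cIterComm Tc b f) ≤
          C * ∏ i, morreyNorm (ps i) (φ1 i) (ωs i) (f i)) ∧
      (phiCond 1 ps φ1 ωs φ2 → ∃ C : ℝ≥0, ∀ f : Fin m → Rn n → ℝ,
        (∀ i, MemMorrey (ps i) (φ1 i) (ωs i) (f i)) →
        morreyNormE p φ2 (nuw p ps ωs) (cSumComm Tc b f) ≤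
          C * ∏ i, morreyNorm (ps i) (φ1 i) (ωs i) (f i))))

/-! ### Multilinear pseudo-differential operators -/

/-- Standard basis directions in `ℝⁿ × (ℝⁿ)^m`: `inl i` is the `i`-th direction in the
`x`-variable, `inr (j,i)` the `i`-th direction in the `j`-th `ξ`-variable. -/
def dirVec (n m : ℕ) : Fin n ⊕ Fin m × Fin n → Rn n × (Fin m → Rn n)
  | Sum.inl i => (EuclideanSpace.single i 1, 0)
  | Sum.inr ji => (0, Pi.single ji.1 (EuclideanSpace.single ji.2 1))

/-- The multilinear Hörmander class `S⁰`: smooth with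
`|∂_x^α ∂_{ξ⃗}^{β⃗} σ| ≤ C (1+Σ|ξᵢ|)^{|α| - |β⃗|}`. -/
def SymbolClass (m : ℕ) (σ : Rn n × (Fin m → Rn n) → ℂ) : Prop :=
  ContDiff ℝ (⊤ : ℕ∞) σ ∧
  ∀ (k : ℕ) (d : Fin k → Fin n ⊕ Fin m × Fin n), ∃ C : ℝ,
    ∀ (x : Rn n) (ξ : Fin m → Rn n),
      ‖iteratedFDeriv ℝ k σ (x, ξ) fun j => dirVec n m (d j)‖ ≤
        C * (1 + ∑ i, ‖ξ i‖) ^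
          (((Finset.univ.filter fun j => (d j).isLeft = true).card : ℝ) -
            ((Finset.univ.filter fun j => (d j).isRight = true).card : ℝ))

/-- The `m`-linear pseudo-differential operator with symbol `σ`. -/
def Tpseudo (m : ℕ) (σ : Rn n × (Fin m → Rn n) → ℂ) (f : Fin m → Rn n → ℂ)
    (x : Rn n) : ℂ :=
  ∫ ξ : Fin m → Rn n,
    σ (x, ξ) * (∏ i, 𝓕 (f i) (ξ i)) *
      Complex.exp (2 * Real.pi * Complex.I * ((∑ i, (inner ℝ x (ξ i) : ℝ) : ℝ) : ℂ))

/-- `T'` is the `j`-th transpose of `T`. -/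
def IsTransposeOf (m : ℕ) (T T' : (Fin m → Rn n → ℂ) → Rn n → ℂ) (j : Fin m) : Prop :=
  ∀ (f : Fin m → Rn n → ℂ) (g : Rn n → ℂ),
    (∀ i, ContDiff ℝ (⊤ : ℕ∞) (f i) ∧ HasCompactSupport (f i)) →
    ContDiff ℝ (⊤ : ℕ∞) g → HasCompactSupport g →
    ∫ x, T f x * g x = ∫ x, T' (Function.update f j g) x * f j x

/-! ### Paraproducts -/

/-- `Ψ_t(x) = t^{-n} Ψ(x/t)`. -/
def dilat (Ψ : Rn n → ℂ) (t : ℝ) : Rn n → ℂ :=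
  fun x => ((t ^ (-(n : ℝ)) : ℝ) : ℂ) * Ψ (t⁻¹ • x)

/-- The Littlewood–Paley piece `Δ_j^Ψ f = f * Ψ_{2^{-j}}`. -/
def DeltaJ (Ψ : Rn n → ℂ) (j : ℤ) (f : Rn n → ℂ) : Rn n → ℂ :=
  fun x => ∫ y, f y * dilat Ψ ((2 : ℝ) ^ (-j)) (x - y)

/-- The partial sum `S_j f = Σ_{k ≤ j} Δ_k^Ψ f`. -/
def SJ (Ψ : Rn n → ℂ) (j : ℤ) (f : Rn n → ℂ) : Rn n → ℂ :=
  fun x => ∑' k : ℤ, if k ≤ j then DeltaJ Ψ k f x else 0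

/-- The bilinear paraproduct `Π₂(f₁,f₂) = Σ_j Δ_j^Ψ(f₁) S_j(f₂)`. -/
def paraprod2 (Ψ : Rn n → ℂ) : (Fin 2 → Rn n → ℂ) → Rn n → ℂ :=
  fun f x => ∑' j : ℤ, DeltaJ Ψ j (f 0) x * SJ Ψ j (f 1) x

/-- The trilinear paraproduct `Π₃(f₁,f₂,f₃) = Σ_j Δ_j^Ψ(f₁) S_j(f₂) S_j(f₃)`. -/
def paraprod3 (Ψ : Rn n → ℂ) : (Fin 3 → Rn n → ℂ) → Rn n → ℂ :=
  fun f x => ∑' j : ℤ, DeltaJ Ψ j (f 0) x * SJ Ψ j (f 1) x * SJ Ψ j (f 2) x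

/-- `Ψ` is a Schwartz function whose Fourier transform is supported in the annulus
`6/7 ≤ |ξ| ≤ 2` and equal to `1` on `1 ≤ |ξ| ≤ 12/7`. -/
def IsLPBump (Ψ : Rn n → ℂ) : Prop :=
  (∃ S : SchwartzMap (Rn n) ℂ, Ψ = ⇑S) ∧
  Function.support (𝓕 Ψ) ⊆ {ξ : Rn n | 6 / 7 ≤ ‖ξ‖ ∧ ‖ξ‖ ≤ 2} ∧
  ∀ ξ : Rn n, 1 ≤ ‖ξ‖ → ‖ξ‖ ≤ 12 / 7 → 𝓕 Ψ ξ = 1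

/-! ### Reverse Hölder-type inequalities for Muckenhoupt weights -/

/-- Hölder's inequality applied to `1 = (∏ wᵢ^θᵢ)^a ∏ (wᵢ^{-1/(qᵢ-1)})^{a θᵢ (qᵢ-1)}`. -/
theorem one_le_lintegral_prod_rpow_mul {α ι : Type*} [MeasurableSpace α] [Fintype ι]
    (μ : Measure α) [IsProbabilityMeasure μ] (w : ι → α → ℝ≥0∞)
    (hw : ∀ i, AEMeasurable (w i) μ) (h0 : ∀ i, ∀ᵐ x ∂μ, w i x ≠ 0)
    (htop : ∀ i, ∀ᵐ x ∂μ, w i x ≠ ⊤) (θ q : ι → ℝ) (hθ : ∀ i, 0 ≤ θ i) (hq : ∀ i, 1 < q i) :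
    1 ≤ (∫⁻ x, ∏ i, w i x ^ θ i ∂μ) *
      ∏ i, (∫⁻ x, w i x ^ (-(1 / (q i - 1))) ∂μ) ^ (θ i * (q i - 1)) := by
  have hc : ∀ i, 0 ≤ θ i * (q i - 1) := fun i => mul_nonneg (hθ i) (by linarith [hq i])
  have hS : 0 < 1 + ∑ i, θ i * (q i - 1) := by
    have := Finset.sum_nonneg fun i (_ : i ∈ Finset.univ) => hc i
    linarith
  obtain ⟨a, ha⟩ : ∃ a, a = (1 + ∑ i, θ i * (q i - 1))⁻¹ := ⟨_, rfl⟩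
  have ha0 : 0 < a := ha ▸ inv_pos.2 hS
  have holder := ENNReal.lintegral_mul_prod_norm_pow_le (μ := μ) Finset.univ
    (g := fun x => ∏ i, w i x ^ θ i) (f := fun i x => w i x ^ (-(1 / (q i - 1))))
    (Finset.aemeasurable_fun_prod _ fun i _ => (hw i).pow_const _)
    (fun i _ => (hw i).pow_const _) a (p := fun i => a * (θ i * (q i - 1)))
    (by rw [← Finset.mul_sum, ← mul_one_add, ha, inv_mul_cancel₀ hS.ne']) ha0.le
    (fun i _ => mul_nonneg ha0.le (hc i))
  have hone : ∫⁻ x, (∏ i, w i x ^ θ i) ^ a *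
      ∏ i, (w i x ^ (-(1 / (q i - 1)))) ^ (a * (θ i * (q i - 1))) ∂μ = 1 := by
    rw [← measure_univ (μ := μ), ← lintegral_one]
    refine lintegral_congr_ae ?_
    filter_upwards [ae_all_iff.2 h0, ae_all_iff.2 htop] with x hx0 hxt
    rw [← ENNReal.prod_rpow_of_nonneg ha0.le, ← Finset.prod_mul_distrib]
    refine Finset.prod_eq_one fun i _ => ?_
    rw [← ENNReal.rpow_mul, ← ENNReal.rpow_mul, ← ENNReal.rpow_add _ _ (hx0 i) (hxt i)]
    have : q i - 1 ≠ 0 := by linarith [hq i]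
    convert ENNReal.rpow_zero using 2
    field_simp
    ring
  rw [hone] at holder
  rw [← ENNReal.rpow_le_rpow_iff ha0, ENNReal.one_rpow, ENNReal.mul_rpow_of_nonneg _ _ ha0.le,
    ← ENNReal.prod_rpow_of_nonneg ha0.le]
  simpa only [← ENNReal.rpow_mul, mul_comm a] using holder

/-- The normalized Lebesgue measure on the ball `B(x,r)`. -/
def ballMeasure (x : Rn n) (r : ℝ) : Measure (Rn n) :=
  (volume (ball x r))⁻¹ • volume.restrict (ball x r)

theorem lintegral_ballMeasure (x : Rn n) (r : ℝ) (g : Rn n → ℝ≥0∞) :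
    ∫⁻ y, g y ∂ballMeasure x r = (volume (ball x r))⁻¹ * ∫⁻ y in ball x r, g y := by
  rw [ballMeasure, lintegral_smul_measure, smul_eq_mul]

theorem ballMeasure_absolutelyContinuous (x : Rn n) (r : ℝ) :
    ballMeasure x r ≪ volume.restrict (ball x r) :=
  Measure.smul_absolutelyContinuous

theorem ballMeasure_absolutelyContinuous_volume (x : Rn n) (r : ℝ) :
    ballMeasure x r ≪ volume :=
  (ballMeasure_absolutelyContinuous x r).trans Measure.restrict_le_self.absolutelyContinuous

theorem volume_ball_ne_zero (x : Rn n) {r : ℝ} (hr : 0 < r) : volume (ball x r) ≠ 0 :=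
  (measure_ball_pos volume x hr).ne'

theorem volume_ball_ne_top (x : Rn n) (r : ℝ) : volume (ball x r) ≠ ⊤ :=
  measure_ball_lt_top.ne

theorem isProbabilityMeasure_ballMeasure (x : Rn n) {r : ℝ} (hr : 0 < r) :
    IsProbabilityMeasure (ballMeasure x r) where
  measure_univ := by
    simp [ballMeasure, ENNReal.inv_mul_cancel (volume_ball_ne_zero x hr) (volume_ball_ne_top x r)]

theorem IsWeight.aemeasurable_ofReal {ω : Rn n → ℝ} (h : IsWeight ω) :
    AEMeasurable (fun x => ENNReal.ofReal (ω x)) volume :=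
  h.1.aestronglyMeasurable.aemeasurable.ennreal_ofReal

theorem IsWeight.ae_ofReal_ne_zero {ω : Rn n → ℝ} (h : IsWeight ω) :
    ∀ᵐ x ∂(volume : Measure (Rn n)), ENNReal.ofReal (ω x) ≠ 0 := by
  filter_upwards [h.2.2] with x hx
  simpa using hx

theorem IsWeight.wMeas_ball_ne_zero {ω : Rn n → ℝ} (h : IsWeight ω) (x : Rn n) {r : ℝ}
    (hr : 0 < r) : wMeas ω (ball x r) ≠ 0 := by
  intro h0
  rw [wMeas, lintegral_eq_zero_iff' h.aemeasurable_ofReal.restrict] at h0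
  have hfalse : ∀ᵐ _ ∂(volume.restrict (ball x r)), False := by
    filter_upwards [h0, ae_restrict_of_ae h.ae_ofReal_ne_zero] with y hy hy' using hy' hy
  rw [eventually_false_iff_eq_bot, ae_eq_bot, Measure.restrict_eq_zero] at hfalse
  exact volume_ball_ne_zero x hr hfalse

theorem IsWeight.wMeas_ball_ne_top {ω : Rn n → ℝ} (h : IsWeight ω) (x : Rn n) (r : ℝ) :
    wMeas ω (ball x r) ≠ ⊤ := by
  have hint : IntegrableOn ω (ball x r) :=
    (h.1.integrableOn_isCompact (isCompact_closedBall x r)).mono_set ball_subset_closedBall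
  exact hint.lintegral_lt_top.ne

theorem lintegral_ballMeasure_weight (ω : Rn n → ℝ) (x : Rn n) (r : ℝ) :
    ∫⁻ y, ENNReal.ofReal (ω y) ∂ballMeasure x r =
      (volume (ball x r))⁻¹ * wMeas ω (ball x r) :=
  lintegral_ballMeasure x r _

/-- An `A_∞` weight satisfies the `A_q` inequality on balls for some `1 < q < ∞`. -/
theorem IsAinf.exists_lintegral_ballMeasure_le {ω : Rn n → ℝ} (h : IsAinf ω) (hω : IsWeight ω) :
    ∃ q : ℝ, 1 < q ∧ ∃ C : ℝ≥0, ∀ (x : Rn n) (r : ℝ), 0 < r →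
      (∫⁻ y, ENNReal.ofReal (ω y) ∂ballMeasure x r) *
        (∫⁻ y, ENNReal.ofReal (ω y) ^ (-(1 / (q - 1))) ∂ballMeasure x r) ^ (q - 1) ≤ C := by
  rcases h with ⟨C, hC⟩ | ⟨q, hq, C, hC⟩
  · refine ⟨2, by norm_num, C, fun x r hr => ?_⟩
    have := isProbabilityMeasure_ballMeasure x hr
    have hB0 := volume_ball_ne_zero x hr
    have hBt := volume_ball_ne_top x r
    obtain ⟨e, he⟩ : ∃ e, e = essInf (fun y => ENNReal.ofReal (ω y))
      (volume.restrict (ball x r)) := ⟨_, rfl⟩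
    have hC' := hC x r hr
    rw [← he] at hC'
    have hle : ∀ᵐ y ∂volume.restrict (ball x r), e ≤ ENNReal.ofReal (ω y) :=
      he ▸ ae_essInf_le
    have he0 : e ≠ 0 := by
      rintro rfl
      exact hω.wMeas_ball_ne_zero x hr (by simpa using hC')
    have het : e ≠ ⊤ := by
      rintro rfl
      have hfalse : ∀ᵐ _ ∂(volume.restrict (ball x r)), False := by
        filter_upwards [hle] with y hy
        simp at hy
      rw [eventually_false_iff_eq_bot, ae_eq_bot, Measure.restrict_eq_zero] at hfalse
      exact hB0 hfalse
    have hS : ∫⁻ y, ENNReal.ofReal (ω y) ^ (-(1 / ((2 : ℝ) - 1))) ∂ballMeasure x r ≤ e⁻¹ := by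
      calc _ ≤ ∫⁻ _, e⁻¹ ∂ballMeasure x r := by
            refine lintegral_mono_ae ?_
            filter_upwards [(ballMeasure_absolutelyContinuous x r).ae_le hle] with y hy
            norm_num [ENNReal.rpow_neg_one]
            exact hy
        _ = e⁻¹ := by simp
    have h21 : ((2 : ℝ) - 1) = 1 := by norm_num
    rw [show ∀ a : ℝ≥0∞, a ^ ((2 : ℝ) - 1) = a by simp [h21], lintegral_ballMeasure_weight]
    calc _ ≤ (volume (ball x r))⁻¹ * (C * volume (ball x r) * e) * e⁻¹ := by gcongr
      _ = C * ((volume (ball x r))⁻¹ * volume (ball x r)) * (e * e⁻¹) := by ring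
      _ = C := by
        rw [ENNReal.inv_mul_cancel hB0 hBt, ENNReal.mul_inv_cancel he0 het, mul_one, mul_one]
  · refine ⟨q, hq, C, fun x r hr => ?_⟩
    rw [lintegral_ballMeasure_weight, lintegral_ballMeasure]
    exact hC x r hr

/-- Hölder's inequality on a ball in terms of the factor of the `A_{P⃗}` condition. -/
theorem lintegral_ballMeasure_le_mul_APfactor {ω : Rn n → ℝ} (hω : IsWeight ω) {q : ℝ}
    (hq : 1 ≤ q) (x : Rn n) (r : ℝ) {g : Rn n → ℝ≥0∞} (hg : AEMeasurable g volume) :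
    ∫⁻ y, g y ∂ballMeasure x r ≤
      (∫⁻ y, g y ^ q * ENNReal.ofReal (ω y) ∂ballMeasure x r) ^ (1 / q) *
        APfactor q ω (ball x r) := by
  have hac := ballMeasure_absolutelyContinuous_volume x r
  have hω0 := hac.ae_le hω.ae_ofReal_ne_zero
  have hωm := hω.aemeasurable_ofReal.mono_ac hac
  have hgm := hg.mono_ac hac
  rcases hq.eq_or_lt with rfl | hq1
  · rw [APfactor, if_pos rfl]
    simp only [ENNReal.rpow_one, div_one]
    rw [← lintegral_mul_const'' _ (hgm.fun_mul hωm)]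
    refine lintegral_mono_ae ?_
    filter_upwards [hω0, (ballMeasure_absolutelyContinuous x r).ae_le
      (ae_essInf_le (μ := volume.restrict (ball x r))
        (f := fun y => ENNReal.ofReal (ω y)))] with y hy0 hy
    calc g y = g y * (ENNReal.ofReal (ω y) * (ENNReal.ofReal (ω y))⁻¹) := by
          rw [ENNReal.mul_inv_cancel hy0 ENNReal.ofReal_ne_top, mul_one]
      _ ≤ _ := by rw [← mul_assoc]; gcongr
  · rw [APfactor, if_neg hq1.ne', ← lintegral_ballMeasure]
    have hq0 : 0 < q := by linarith
    have hq1' : 0 < q - 1 := by linarith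
    refine le_trans (lintegral_mono_ae ?_) (ENNReal.lintegral_mul_norm_pow_le
      ((hgm.pow_const q).mul hωm) (hωm.pow_const _) (by positivity) (by positivity)
      (by field_simp; ring))
    filter_upwards [hω0] with y hy0
    simp only [Pi.mul_apply]
    rw [ENNReal.mul_rpow_of_nonneg _ _ (by positivity), ← ENNReal.rpow_mul, ← ENNReal.rpow_mul,
      mul_assoc, ← ENNReal.rpow_add _ _ hy0 ENNReal.ofReal_ne_top]
    have e1 : q * (1 / q) = 1 := by field_simp
    have e2 : 1 / q + -(1 / (q - 1)) * ((q - 1) / q) = 0 := by field_simp; ring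
    rw [e1, e2]
    simp

/-- For `ω⃗ ∈ A_{P⃗} ∩ (A_∞)^m`, the weights separately satisfy the `A_{P⃗}` inequality. -/
theorem IsMultiAP.exists_prod_lintegral_mul_APfactor_le {ps : Fin m → ℝ} {p : ℝ}
    (hps : ∀ i, 1 ≤ ps i) (hp : p⁻¹ = ∑ i, (ps i)⁻¹) {ωs : Fin m → Rn n → ℝ}
    (hw : ∀ i, IsWeight (ωs i)) (hAP : IsMultiAP p ps ωs) (hAinf : ∀ i, IsAinf (ωs i)) :
    ∃ C : ℝ≥0, ∀ (x : Rn n) (r : ℝ), 0 < r →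
      ∏ i, ((∫⁻ y, ENNReal.ofReal (ωs i y) ∂ballMeasure x r) ^ (1 / ps i) *
        APfactor (ps i) (ωs i) (ball x r)) ≤ C := by
  rcases isEmpty_or_nonempty (Fin m) with hm | hm
  · exact ⟨1, fun x r _ => by simp⟩
  have hps0 : ∀ i, 0 < ps i := fun i => by linarith [hps i]
  have hp0 : 0 < p := by
    rw [← inv_pos, hp]
    exact Finset.sum_pos (fun i _ => inv_pos.2 (hps0 i)) Finset.univ_nonempty
  have hθ : ∀ i, 0 ≤ p / ps i := fun i => (div_pos hp0 (hps0 i)).le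
  choose q hq D hD using fun i => (hAinf i).exists_lintegral_ballMeasure_le (hw i)
  obtain ⟨C, hC⟩ := hAP
  refine ⟨(∏ i, D i ^ (p / ps i)) ^ (1 / p) * C, fun x r hr => ?_⟩
  have := isProbabilityMeasure_ballMeasure x hr
  have hac := ballMeasure_absolutelyContinuous_volume x r
  have hν : ∫⁻ y, ∏ i, ENNReal.ofReal (ωs i y) ^ (p / ps i) ∂ballMeasure x r =
      (volume (ball x r))⁻¹ * wMeas (nuw p ps ωs) (ball x r) := by
    rw [← lintegral_ballMeasure_weight]
    refine lintegral_congr fun y => ?_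
    rw [nuw, ENNReal.ofReal_prod_of_nonneg fun i _ => Real.rpow_nonneg ((hw i).2.1 y) _]
    exact Finset.prod_congr rfl fun i _ =>
      ENNReal.ofReal_rpow_of_nonneg ((hw i).2.1 y) (hθ i)
  have hrev := one_le_lintegral_prod_rpow_mul (ballMeasure x r)
    (fun i y => ENNReal.ofReal (ωs i y)) (fun i => (hw i).aemeasurable_ofReal.mono_ac hac)
    (fun i => hac.ae_le (hw i).ae_ofReal_ne_zero)
    (fun i => Eventually.of_forall fun y => ENNReal.ofReal_ne_top) (fun i => p / ps i) q hθ hq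
  rw [hν] at hrev
  have hC' := hC x r hr
  set V := (volume (ball x r))⁻¹ * wMeas (nuw p ps ωs) (ball x r)
  set W := fun i => ∫⁻ y, ENNReal.ofReal (ωs i y) ∂ballMeasure x r
  set S := fun i => ∫⁻ y, ENNReal.ofReal (ωs i y) ^ (-(1 / (q i - 1))) ∂ballMeasure x r
  have hprod : ∏ i, W i ^ (p / ps i) ≤ (∏ i, (D i : ℝ≥0∞) ^ (p / ps i)) * V := by
    calc ∏ i, W i ^ (p / ps i)
        ≤ (∏ i, W i ^ (p / ps i)) * (V * ∏ i, S i ^ (p / ps i * (q i - 1))) :=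
          le_mul_of_one_le_right' hrev
      _ = (∏ i, (W i * S i ^ (q i - 1)) ^ (p / ps i)) * V := by
          rw [mul_left_comm, ← Finset.prod_mul_distrib, mul_comm]
          congr 1
          refine Finset.prod_congr rfl fun i _ => ?_
          rw [ENNReal.mul_rpow_of_nonneg _ _ (hθ i), ← ENNReal.rpow_mul, mul_comm (p / ps i)]
      _ ≤ _ := by
          gcongr with i
          · exact hθ i
          · exact hD i x r hr
  have hroot : ∏ i, W i ^ (1 / ps i) ≤
      (∏ i, (D i : ℝ≥0∞) ^ (p / ps i)) ^ (1 / p) * V ^ (1 / p) := by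
    rw [← ENNReal.mul_rpow_of_nonneg _ _ (by positivity)]
    refine le_trans (le_of_eq ?_) (ENNReal.rpow_le_rpow hprod (by positivity))
    rw [← ENNReal.prod_rpow_of_nonneg (by positivity)]
    refine Finset.prod_congr rfl fun i _ => ?_
    rw [← ENNReal.rpow_mul]
    congr 1
    field_simp
  have hcoe : ((∏ i, D i ^ (p / ps i)) ^ (1 / p) : ℝ≥0) =
      (∏ i, (D i : ℝ≥0∞) ^ (p / ps i)) ^ (1 / p) := by
    rw [ENNReal.coe_rpow_of_nonneg _ (one_div_pos.2 hp0).le, ENNReal.ofNNReal_finsetProd]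
    simp_rw [ENNReal.coe_rpow_of_nonneg _ (hθ _)]
  rw [Finset.prod_mul_distrib, ENNReal.coe_mul, hcoe]
  calc _ ≤ ((∏ i, (D i : ℝ≥0∞) ^ (p / ps i)) ^ (1 / p) * V ^ (1 / p)) *
        ∏ i, APfactor (ps i) (ωs i) (ball x r) := by gcongr
    _ ≤ _ := by rw [mul_assoc]; gcongr

/-- On a ball, the product of the averages of `fᵢ` is controlled by the product of the normalized
weighted `L^{pᵢ}` norms. -/
theorem IsMultiAP.exists_prod_lintegral_ballMeasure_le {ps : Fin m → ℝ} {p : ℝ}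
    (hps : ∀ i, 1 ≤ ps i) (hp : p⁻¹ = ∑ i, (ps i)⁻¹) {ωs : Fin m → Rn n → ℝ}
    (hw : ∀ i, IsWeight (ωs i)) (hAP : IsMultiAP p ps ωs) (hAinf : ∀ i, IsAinf (ωs i)) :
    ∃ C : ℝ≥0, ∀ (x : Rn n) (r : ℝ), 0 < r → ∀ f : Fin m → Rn n → ℝ,
      (∀ i, AEMeasurable (f i) volume) →
      ∏ i, ∫⁻ y, ENNReal.ofReal |f i y| ∂ballMeasure x r ≤
        C * ∏ i, (wLpNorm (ps i) (ωs i) (ball x r) (f i) *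
          wMeas (ωs i) (ball x r) ^ (-(1 / ps i))) := by
  obtain ⟨C, hC⟩ := hAP.exists_prod_lintegral_mul_APfactor_le hps hp hw hAinf
  refine ⟨C, fun x r hr f hf => ?_⟩
  refine le_trans ?_ (mul_le_mul_left (hC x r hr) _)
  rw [← Finset.prod_mul_distrib]
  refine Finset.prod_le_prod' fun i _ => ?_
  have hpi : 0 ≤ 1 / ps i := by have := hps i; positivity
  have hg : AEMeasurable (fun y => ENNReal.ofReal |f i y|) volume :=
    (continuous_abs.measurable.comp_aemeasurable (hf i)).ennreal_ofReal
  refine (lintegral_ballMeasure_le_mul_APfactor (hw i) (hps i) x r hg).trans (le_of_eq ?_)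
  have hB0 : (volume (ball x r))⁻¹ ≠ 0 := ENNReal.inv_ne_zero.2 (volume_ball_ne_top x r)
  have hBt : (volume (ball x r))⁻¹ ≠ ⊤ := ENNReal.inv_ne_top.2 (volume_ball_ne_zero x hr)
  have hW0 := (hw i).wMeas_ball_ne_zero x hr
  have hWt := (hw i).wMeas_ball_ne_top x r
  rw [lintegral_ballMeasure, lintegral_ballMeasure_weight, ENNReal.mul_rpow_of_nonneg _ _ hpi,
    ENNReal.mul_rpow_of_nonneg _ _ hpi, wLpNorm, wLpNormE]
  have hcancel : wMeas (ωs i) (ball x r) ^ (1 / ps i) *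
      wMeas (ωs i) (ball x r) ^ (-(1 / ps i)) = 1 := by
    rw [← ENNReal.rpow_add _ _ hW0 hWt, add_neg_cancel, ENNReal.rpow_zero]
  calc _ = (volume (ball x r))⁻¹ ^ (1 / ps i) *
        (∫⁻ y in ball x r, ENNReal.ofReal |f i y| ^ ps i * ENNReal.ofReal (ωs i y)) ^ (1 / ps i) *
          APfactor (ps i) (ωs i) (ball x r) * 1 := by rw [mul_one]
    _ = _ := by rw [← hcancel]; ring

theorem lintegral_ballMeasure_le_of_le_two_mul (x : Rn n) {s t : ℝ} (hs : 0 < s) (hst : s ≤ t)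
    (hts : t ≤ 2 * s) (g : Rn n → ℝ≥0∞) :
    ∫⁻ y, g y ∂ballMeasure x s ≤ 2 ^ n * ∫⁻ y, g y ∂ballMeasure x t := by
  rw [lintegral_ballMeasure, lintegral_ballMeasure, ← mul_assoc]
  refine mul_le_mul' ?_ (lintegral_mono_set (ball_subset_ball hst))
  have hvol : volume (ball x t) ≤ 2 ^ n * volume (ball x s) := by
    refine (measure_mono (ball_subset_ball hts)).trans (le_of_eq ?_)
    rw [Measure.addHaar_ball_mul_of_pos _ _ two_pos, ← Measure.addHaar_ball_center _ x]
    simp [ENNReal.ofReal_pow]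
  have hs0 := volume_ball_ne_zero x hs
  have hst' := volume_ball_ne_top x s
  have ht0 := volume_ball_ne_zero x (hs.trans_le hst)
  have htt := volume_ball_ne_top x t
  rw [← div_eq_mul_inv, ENNReal.le_div_iff_mul_le (Or.inl ht0) (Or.inl htt)]
  calc _ ≤ (volume (ball x s))⁻¹ * (2 ^ n * volume (ball x s)) := by gcongr
    _ = 2 ^ n := by
      rw [mul_left_comm, ENNReal.inv_mul_cancel hs0 hst', mul_one]

/-- A series is controlled by an integral over `(2r,∞)` with respect to `dt/t` if its terms are
controlled by the integrand on dyadic intervals. -/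
theorem tsum_le_lintegral_of_dyadic_le {a : ℕ → ℝ≥0∞} {G : ℝ → ℝ≥0∞} {r : ℝ} (hr : 0 < r)
    (h : ∀ (j : ℕ) (t : ℝ), 2 ^ (j + 2) * r < t → t ≤ 2 * (2 ^ (j + 2) * r) → a j ≤ G t) :
    ∑' j, a j ≤ 2 * ∫⁻ t in Ioi (2 * r), G t * (ENNReal.ofReal t)⁻¹ := by
  let u : ℕ → ℝ := fun j => 2 ^ (j + 2) * r
  have hu0 : ∀ j, 0 < u j := fun j => by positivity
  have hu : ∀ j, u (j + 1) = 2 * u j := fun j => by simp only [u]; ring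
  have hmono : Monotone u := monotone_nat_of_le_succ fun j => by linarith [hu0 j, hu j]
  have hterm : ∀ j, a j ≤ 2 * ∫⁻ t in Ioc (u j) (u (j + 1)), G t * (ENNReal.ofReal t)⁻¹ := by
    intro j
    have hlow : a j * (ENNReal.ofReal (u (j + 1)))⁻¹ * ENNReal.ofReal (u j) ≤
        ∫⁻ t in Ioc (u j) (u (j + 1)), G t * (ENNReal.ofReal t)⁻¹ := by
      calc _ = ∫⁻ _ in Ioc (u j) (u (j + 1)), a j * (ENNReal.ofReal (u (j + 1)))⁻¹ := by
            rw [setLIntegral_const, Real.volume_Ioc, hu]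
            congr 2
            ring
        _ ≤ _ := by
            refine setLIntegral_mono' measurableSet_Ioc fun t ht => ?_
            gcongr
            · exact h j t ht.1 (ht.2.trans_eq (hu j))
            · exact ht.2
    refine le_trans (le_of_eq ?_) (mul_le_mul_right hlow 2)
    have h0 : ENNReal.ofReal (u (j + 1)) ≠ 0 := by simpa using hu0 (j + 1)
    calc a j = a j * ((ENNReal.ofReal (u (j + 1)))⁻¹ * ENNReal.ofReal (u (j + 1))) := by
          rw [ENNReal.inv_mul_cancel h0 ENNReal.ofReal_ne_top, mul_one]
      _ = a j * ((ENNReal.ofReal (u (j + 1)))⁻¹ * (2 * ENNReal.ofReal (u j))) := by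
          nth_rw 2 [hu]
          rw [ENNReal.ofReal_mul zero_le_two, ENNReal.ofReal_ofNat]
      _ = _ := by ring
  calc ∑' j, a j ≤ ∑' j, 2 * ∫⁻ t in Ioc (u j) (u (j + 1)), G t * (ENNReal.ofReal t)⁻¹ :=
        ENNReal.tsum_le_tsum hterm
    _ = 2 * ∫⁻ t in ⋃ j, Ioc (u j) (u (j + 1)), G t * (ENNReal.ofReal t)⁻¹ := by
        rw [ENNReal.tsum_mul_left, lintegral_iUnion (fun _ => measurableSet_Ioc)
          (by simpa only [Nat.succ_eq_succ] using hmono.pairwise_disjoint_on_Ioc_succ)]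
    _ ≤ _ := by
        gcongr
        refine iUnion_subset fun j t ht => ?_
        have : u 0 ≤ u j := hmono (Nat.zero_le j)
        have h4 : u 0 = 4 * r := by simp only [u]; norm_num
        exact lt_of_le_of_lt (by linarith) ht.1

/-- inequality (3.1): for `ω⃗ ∈ A_{P⃗} ∩ (A_∞)^m` and any ball `B(x₀,r)`,
`Σ_{j=1}^∞ ∏ᵢ |2^{j+1}B|⁻¹ ∫_{2^{j+1}B} |fᵢ| ≲
  ∫_{2r}^∞ ∏ᵢ ‖fᵢ‖_{L^{pᵢ}(B(x₀,t),ωᵢdx)} ωᵢ(B(x₀,t))^{-1/pᵢ} dt/t`,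
with a constant independent of `x₀`, `r` and `f⃗`. -/
theorem stmt18 {n m : ℕ} (ps : Fin m → ℝ) (p : ℝ)
    (hps : ∀ i, 1 ≤ ps i) (hp : p⁻¹ = ∑ i, (ps i)⁻¹)
    (ωs : Fin m → Rn n → ℝ) (hw : ∀ i, IsWeight (ωs i))
    (hAP : IsMultiAP p ps ωs) (hAinf : ∀ i, IsAinf (ωs i)) :
    ∃ C : ℝ≥0, ∀ (x₀ : Rn n) (r : ℝ), 0 < r → ∀ f : Fin m → Rn n → ℝ,
      (∀ i, AEMeasurable (f i) volume) →
      (∀ i (R : ℝ), 0 < R → wLpNorm (ps i) (ωs i) (ball x₀ R) (f i) < ⊤) →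
      lsSum x₀ r f ≤
        C * ∫⁻ t in Ioi (2 * r),
          (∏ i, wLpNorm (ps i) (ωs i) (ball x₀ t) (f i) *
            wMeas (ωs i) (ball x₀ t) ^ (-(1 / ps i))) * (ENNReal.ofReal t)⁻¹ := by
  obtain ⟨C, hC⟩ := hAP.exists_prod_lintegral_ballMeasure_le hps hp hw hAinf
  refine ⟨2 * ((2 ^ n) ^ m * C), fun x₀ r hr f hf _ => ?_⟩
  have hsum : lsSum x₀ r f ≤ 2 * ∫⁻ t in Ioi (2 * r),
      ((2 ^ n) ^ m * C : ℝ≥0∞) * (∏ i, wLpNorm (ps i) (ωs i) (ball x₀ t) (f i) *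
        wMeas (ωs i) (ball x₀ t) ^ (-(1 / ps i))) * (ENNReal.ofReal t)⁻¹ := by
    refine tsum_le_lintegral_of_dyadic_le hr fun j t hjt htj => ?_
    have hj : 0 < 2 ^ (j + 2) * r := by positivity
    simp_rw [← lintegral_ballMeasure]
    calc _ ≤ ∏ i, 2 ^ n * ∫⁻ y, ENNReal.ofReal |f i y| ∂ballMeasure x₀ t :=
          Finset.prod_le_prod' fun i _ =>
            lintegral_ballMeasure_le_of_le_two_mul x₀ hj hjt.le htj _
      _ = (2 ^ n) ^ m * ∏ i, ∫⁻ y, ENNReal.ofReal |f i y| ∂ballMeasure x₀ t := by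
          rw [Finset.prod_mul_distrib, Finset.prod_const, Finset.card_univ, Fintype.card_fin]
      _ ≤ _ := by
          rw [mul_assoc]
          gcongr
          exact hC x₀ t (hj.trans hjt) f hf
  refine hsum.trans (le_of_eq ?_)
  simp_rw [mul_assoc ((2 ^ n) ^ m * C : ℝ≥0∞)]
  rw [lintegral_const_mul' _ _ (by finiteness), ← mul_assoc]
  push_cast
  rfl
end GWM
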